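/- Let K satisfy Assumption A, let T > 0, and let f be a mass-conserving weak solution of the coagulation equation on [0,T] with kernel K and initial datum f_in, where f_in is nonzero and is not a single Dirac measure. For R > 0 and m ∈ ℕ set M_{R,m}(f(t)) := ∫_{[R,∞)} (v − R)^m f(dv,t). Then for each t ∈ (0,T], liminf_{R→∞} liminf_{m→∞} (M_{R,m}(f(t)))^{1/m} = ∞; more precisely, for every R > 0, liminf_{m→∞} (M_{R,m}(f(t)))^{1/m} ≥ R. -/

import Mathlib

open MeasureTheory Set Filter

noncomputable section

/-- Assumption A on the coagulation kernel `K(v,v') = h(v,v') g(v/(v+v'))`. -/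
structure KernelAssumptionA (K : ℝ → ℝ → ℝ) (h : ℝ → ℝ → ℝ) (g : ℝ → ℝ)
    (γ H H₀ H₁ G₀ G₁ k : ℝ) : Prop where
  K_nonneg : ∀ v v', 0 ≤ v → 0 ≤ v' → 0 ≤ K v v'
  K_eq : ∀ v v', 0 ≤ v → 0 ≤ v' → 0 < v + v' →
      K v v' = h v v' * g (v / (v + v'))
  h_cont : ContinuousOn (fun p : ℝ × ℝ => h p.1 p.2) (Ici 0 ×ˢ Ici 0)
  h_symm : ∀ v v', h v v' = h v' v
  γ_gt_one : 1 < γ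
  H_gt_one : 1 < H
  H₀_pos : 0 < H₀
  h_lower : ∀ v v', 0 ≤ v → 0 ≤ v' → H < v + v' →
      H₀ * (v ^ γ + v' ^ γ) ≤ h v v'
  h_posOn : ∀ R : ℝ, 0 < R → ∃ C : ℝ, 0 < C ∧
      ∀ v ∈ Icc (1 / R) R, ∀ v' ∈ Icc (1 / R) R, C ≤ h v v'
  H₁_pos : 0 < H₁
  h_upper : ∀ v v', 0 ≤ v → 0 ≤ v' → h v v' ≤ H₁ * (v ^ γ + v' ^ γ)
  g_cont : ContinuousOn g (Icc 0 1)
  g_symm : ∀ x ∈ Icc (0 : ℝ) 1, g x = g (1 - x)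
  g_half : g (1 / 2) = 0
  G₀_pos : 0 < G₀
  G₁_pos : 0 < G₁
  k_ge_one : 1 ≤ k
  g_lower : ∀ x ∈ Icc (0 : ℝ) 1, G₀ * |x - 1 / 2| ^ k ≤ g x
  g_upper : ∀ x ∈ Icc (0 : ℝ) 1, g x ≤ G₁

/-- Weak solution of the coagulation equation on `[0, T]` with kernel `K`
and initial datum `fin`, in the sense of measures on `(0,∞)`. -/
structure IsWeakSolution (K : ℝ → ℝ → ℝ) (γ T : ℝ)
    (f : ℝ → Measure ℝ) (fin : Measure ℝ) : Prop where
  conc : ∀ t ∈ Icc (0 : ℝ) T, f t (Iic 0) = 0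
  time_cont : ∀ φ : ℝ → ℝ, Continuous φ → (∃ M : ℝ, ∀ v, |φ v| ≤ M) →
      ContinuousOn (fun t => ∫ v, φ v ∂(f t)) (Icc (0 : ℝ) T)
  moment_bound : ∃ C : ℝ, ∀ t ∈ Icc (0 : ℝ) T,
      Integrable (fun v => 1 + v ^ γ) (f t) ∧ (∫ v, (1 + v ^ γ) ∂(f t)) ≤ C
  weak_form : ∀ φ : ℝ → ℝ, Continuous φ → HasCompactSupport φ →
      tsupport φ ⊆ Ioi 0 → ∀ t ∈ Icc (0 : ℝ) T,
      (∫ v, φ v ∂(f t)) - (∫ v, φ v ∂fin) =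
        (1 / 2) * ∫ s in (0 : ℝ)..t,
          (∫ v, (∫ v', K v v' * (φ (v + v') - φ v - φ v') ∂(f s)) ∂(f s))

/-- The solution conserves mass on `[0, T]`. -/
def IsMassConserving (T : ℝ) (f : ℝ → Measure ℝ) (fin : Measure ℝ) : Prop :=
  Integrable (fun v => v) fin ∧
    ∀ t ∈ Icc (0 : ℝ) T,
      Integrable (fun v => v) (f t) ∧ (∫ v, v ∂(f t)) = ∫ v, v ∂fin

/-- `μ` is a single Dirac measure `M • δ_V` with `M, V ∈ (0,∞)`. -/
def IsSingleDirac (μ : Measure ℝ) : Prop :=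
  ∃ M V : ℝ, 0 < M ∧ 0 < V ∧ μ = ENNReal.ofReal M • Measure.dirac V

open Topology

/-- Weakly continuous families of measures give measurable measure-valued maps. -/
lemma meas_family (T : ℝ) (hT : 0 < T) (f : ℝ → Measure ℝ)
    (hfin : ∀ t ∈ Icc (0 : ℝ) T, IsFiniteMeasure (f t))
    (hc : ∀ φ : ℝ → ℝ, Continuous φ → (∃ M : ℝ, ∀ v, |φ v| ≤ M) →
      ContinuousOn (fun t => ∫ v, φ v ∂(f t)) (Icc (0 : ℝ) T)) :
    Measurable (fun s : ℝ => f (max 0 (min s T))) := by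
  have hmem : ∀ s : ℝ, max 0 (min s T) ∈ Icc (0 : ℝ) T := fun s =>
    ⟨le_max_left _ _, max_le hT.le (min_le_right _ _)⟩
  have hF : ∀ s : ℝ, IsFiniteMeasure (f (max 0 (min s T))) := fun s => hfin _ (hmem s)
  have hcl : ∀ F : Set ℝ, IsClosed F → Measurable (fun s : ℝ => f (max 0 (min s T)) F) := by
    intro F hFc
    refine measurable_of_tendsto_metrizable (f := fun n s => ∫⁻ x, hFc.apprSeq n x ∂(f (max 0 (min s T)))) ?_ ?_
    · intro n
      have e : ∀ s : ℝ, ∫⁻ x, hFc.apprSeq n x ∂(f (max 0 (min s T)))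
          = ENNReal.ofReal (∫ x, ((hFc.apprSeq n x : NNReal) : ℝ) ∂(f (max 0 (min s T)))) := by
        intro s
        rw [ofReal_integral_eq_lintegral_ofReal]
        · simp
        · refine Integrable.of_bound (C := 1) ?_ ?_
          · exact (NNReal.continuous_coe.comp (hFc.apprSeq n).continuous).aestronglyMeasurable
          · refine Eventually.of_forall fun x => ?_
            have := HasOuterApproxClosed.apprSeq_apply_le_one hFc n x
            simpa using this
        · exact Eventually.of_forall fun x => NNReal.coe_nonneg _
      simp only [e]
      apply ENNReal.measurable_ofReal.comp
      have h1 := hc (fun x => ((hFc.apprSeq n x : NNReal) : ℝ))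
        (NNReal.continuous_coe.comp (hFc.apprSeq n).continuous) ⟨1, fun x => by
            have := HasOuterApproxClosed.apprSeq_apply_le_one hFc n x
            simpa using this⟩
      have h2 : Continuous (fun s : ℝ => ∫ x, ((hFc.apprSeq n x : NNReal) : ℝ) ∂(f (max 0 (min s T)))) :=
        h1.comp_continuous (f := fun s : ℝ => max 0 (min s T)) (by fun_prop) hmem
      exact h2.measurable
    · rw [tendsto_pi_nhds]
      intro s
      exact HasOuterApproxClosed.tendsto_lintegral_apprSeq hFc _
  refine Measurable.measure_of_isPiSystem (S := {s : Set ℝ | IsClosed s}) ?_ isPiSystem_isClosed hcl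
    (hcl _ isClosed_univ)
  rw [BorelSpace.measurable_eq (α := ℝ), borel_eq_generateFrom_isClosed]

/-- The product integral is measurable in time. -/
lemma meas_prod (μ : ℝ → Measure ℝ) (hμ : Measurable μ) (C : ENNReal) (hC : C < ⊤)
    (hb : ∀ s, μ s univ ≤ C) (G : ℝ × ℝ → ℝ) (hG : Measurable G) :
    Measurable (fun s => ∫ p, G p ∂((μ s).prod (μ s))) := by
  let κ : ProbabilityTheory.Kernel ℝ ℝ := ⟨μ, hμ⟩
  have : ProbabilityTheory.IsFiniteKernel κ := ⟨C, hC, hb⟩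
  have h := MeasureTheory.StronglyMeasurable.integral_kernel_prod_right' (κ := κ.prod κ)
    (f := fun q : ℝ × (ℝ × ℝ) => G q.2) (hG.comp measurable_snd).stronglyMeasurable
  have h2 := h.measurable
  simp only [ProbabilityTheory.Kernel.prod_apply] at h2
  exact h2

/-- Two separated regions charged by a measure which is not a single Dirac. -/
lemma two_regions (μ : Measure ℝ) [IsFiniteMeasure μ] (h0 : μ (Iic 0) = 0) (hne : μ ≠ 0)
    (hd : ¬ IsSingleDirac μ) :
    ∃ a₁ a₂ b₁ b₂ : ℝ, 0 < a₁ ∧ a₁ < a₂ ∧ a₂ < b₁ ∧ b₁ < b₂ ∧ 0 < μ (Ioo a₁ a₂) ∧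
      0 < μ (Ioo b₁ b₂) := by
  have hnn : ∀ x ∈ μ.support, 0 ≤ x := by
    intro x hx
    by_contra hlt
    push Not at hlt
    have := (Measure.mem_support_iff_forall x).1 hx (Iic 0) (Iic_mem_nhds hlt)
    rw [h0] at this
    exact lt_irrefl _ this
  have key : ∃ x ∈ μ.support, ∃ y ∈ μ.support, x < y := by
    by_contra hcon
    push Not at hcon
    obtain ⟨V, hV⟩ := Measure.nonempty_support hne
    have hsub : ∀ y ∈ μ.support, y = V := fun y hy => le_antisymm (hcon V hV y hy) (hcon y hy V hV)
    have hae : ∀ᵐ y ∂μ, y = V := by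
      filter_upwards [Measure.support_mem_ae (μ := μ)] with y hy using hsub y hy
    have hc : μ {V}ᶜ = 0 := hae
    have hVpos : 0 < V := by
      rcases (hnn V hV).lt_or_eq with h | h
      · exact h
      · exfalso
        apply hne
        rw [← Measure.measure_univ_eq_zero]
        refine measure_mono_null (t := Iic 0 ∪ {V}ᶜ) ?_ (measure_union_null h0 hc)
        intro y _
        by_cases hy : y = V
        · left; simp [hy, ← h]
        · right; simpa using hy
    have hu : μ univ ≠ 0 := by simpa using hne
    have e : μ = μ univ • Measure.dirac V := by
      ext s hs
      by_cases hVs : V ∈ s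
      · have : μ s = μ univ := measure_congr (by
          filter_upwards [hae] with y hy
          simp only [hy]
          apply propext
          exact ⟨fun _ => trivial, fun _ => hVs⟩)
        simp [Measure.dirac_apply' _ hs, hVs, this]
      · have : μ s = 0 := measure_mono_null (fun y hy => by
          simp only [mem_compl_iff, mem_singleton_iff]; rintro rfl; exact hVs hy) hc
        simp [Measure.dirac_apply' _ hs, hVs, this]
    refine hd ⟨(μ univ).toReal, V, ENNReal.toReal_pos hu (measure_ne_top _ _), hVpos, ?_⟩
    rw [ENNReal.ofReal_toReal (measure_ne_top _ _)]
    exact e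
  obtain ⟨x, hx, y, hy, hxy⟩ := key
  have hx0 := hnn x hx
  have hA : 0 < μ (Ioo 0 (x + (y - x) / 3)) := by
    have h1 := (Measure.mem_support_iff_forall x).1 hx (Iio (x + (y - x) / 3))
      (Iio_mem_nhds (by linarith))
    by_contra hz
    have hz' : μ (Ioo 0 (x + (y - x) / 3)) = 0 := by simpa using hz
    have : μ (Iio (x + (y - x) / 3)) = 0 := by
      refine measure_mono_null (t := Iic 0 ∪ Ioo 0 (x + (y - x) / 3)) ?_ (measure_union_null h0 hz')
      intro z hz
      rcases le_or_gt z 0 with h | h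
      · exact Or.inl h
      · exact Or.inr ⟨h, hz⟩
    rw [this] at h1
    exact lt_irrefl _ h1
  have hA' : ∃ n : ℕ, 0 < μ (Ioo (1 / ((n : ℝ) + 1)) (x + (y - x) / 3)) := by
    by_contra hcon
    push Not at hcon
    have : μ (⋃ n : ℕ, Ioo (1 / ((n : ℝ) + 1)) (x + (y - x) / 3)) = 0 :=
      measure_iUnion_null fun n => by simpa using hcon n
    refine hA.ne' (measure_mono_null ?_ this)
    intro z hz
    obtain ⟨n, hn⟩ := exists_nat_one_div_lt hz.1
    exact mem_iUnion.2 ⟨n, hn, hz.2⟩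
  obtain ⟨n, hn⟩ := hA'
  refine ⟨1 / ((n : ℝ) + 1), x + (y - x) / 3, x + (y - x) / 2, y + 1, by positivity, ?_, by linarith,
    by linarith, hn, ?_⟩
  · by_contra hcon
    rw [Ioo_eq_empty hcon] at hn
    simp at hn
  · exact (Measure.mem_support_iff_forall y).1 hy _ (Ioo_mem_nhds (by linarith) (by linarith))

/-- Once the support is unbounded, tail moments diverge. -/
lemma liminf_top (μ : Measure ℝ) [IsFiniteMeasure μ] (hμ : ∀ L : ℝ, 0 < μ (Ioi L)) (R : ℝ) :
    Filter.liminf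
          (fun m : ℕ =>
            (∫⁻ v in Ici R, ENNReal.ofReal ((v - R) ^ m) ∂μ) ^ (1 / (m : ℝ)))
          Filter.atTop = ⊤ := by
  rw [eq_top_iff]
  refine ENNReal.le_of_forall_nnreal_lt fun r _ => ?_
  set L : ℝ := R + (r + 1) with hL
  have hlow : ∀ m : ℕ, 1 ≤ m → ENNReal.ofReal (r + 1) * (μ (Ioi L)) ^ (1 / (m : ℝ)) ≤
      (∫⁻ v in Ici R, ENNReal.ofReal ((v - R) ^ m) ∂μ) ^ (1 / (m : ℝ)) := by
    intro m hm
    have hm0 : (m : ℝ) ≠ 0 := by positivity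
    have h1 : ENNReal.ofReal (r + 1) ^ m * μ (Ioi L) ≤
        ∫⁻ v in Ici R, ENNReal.ofReal ((v - R) ^ m) ∂μ := by
      calc ENNReal.ofReal (r + 1) ^ m * μ (Ioi L)
          = ∫⁻ v in Ioi L, ENNReal.ofReal (r + 1) ^ m ∂μ := by rw [setLIntegral_const]
        _ ≤ ∫⁻ v in Ioi L, ENNReal.ofReal ((v - R) ^ m) ∂μ := by
            refine setLIntegral_mono' measurableSet_Ioi fun v hv => ?_
            rw [← ENNReal.ofReal_pow (by positivity)]
            apply ENNReal.ofReal_le_ofReal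
            have : (r : ℝ) + 1 ≤ v - R := by
              have : L < v := hv
              linarith
            gcongr
        _ ≤ _ := lintegral_mono_set (fun v hv => by
            have h2 : L < v := hv
            have h3 : (0 : ℝ) ≤ r := r.2
            show R ≤ v
            linarith)
    calc ENNReal.ofReal (r + 1) * (μ (Ioi L)) ^ (1 / (m : ℝ))
        = (ENNReal.ofReal (r + 1) ^ m * μ (Ioi L)) ^ (1 / (m : ℝ)) := by
          rw [ENNReal.mul_rpow_of_nonneg _ _ (by positivity), ← ENNReal.rpow_natCast,
            ← ENNReal.rpow_mul, mul_one_div_cancel hm0, ENNReal.rpow_one]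
      _ ≤ _ := ENNReal.rpow_le_rpow h1 (by positivity)
  have hlim : Tendsto (fun m : ℕ => ENNReal.ofReal (r + 1) * (μ (Ioi L)) ^ (1 / (m : ℝ))) atTop
      (𝓝 (ENNReal.ofReal (r + 1))) := by
    have h0 : Tendsto (fun m : ℕ => 1 / (m : ℝ)) atTop (𝓝 0) := tendsto_one_div_atTop_nhds_zero_nat
    have hx : (μ (Ioi L)).toReal ≠ 0 := (ENNReal.toReal_pos (hμ L).ne' (measure_ne_top _ _)).ne'
    have h1 : Tendsto (fun m : ℕ => (μ (Ioi L)) ^ (1 / (m : ℝ))) atTop (𝓝 1) := by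
      have h2 : Tendsto (fun m : ℕ => (μ (Ioi L)).toReal ^ (1 / (m : ℝ))) atTop (𝓝 1) := by
        have := (Real.continuousAt_const_rpow (b := 0) hx).tendsto.comp h0
        rw [Real.rpow_zero] at this
        exact this
      have h3 := ENNReal.tendsto_ofReal h2
      simp only [ENNReal.ofReal_one] at h3
      refine h3.congr fun m => ?_
      rw [← ENNReal.ofReal_rpow_of_nonneg ENNReal.toReal_nonneg (by positivity),
        ENNReal.ofReal_toReal (measure_ne_top _ _)]
    have := ENNReal.Tendsto.const_mul (a := ENNReal.ofReal (r + 1)) h1 (Or.inl one_ne_zero)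
    simpa using this
  calc (r : ENNReal) ≤ ENNReal.ofReal (r + 1) := by
        rw [← ENNReal.ofReal_coe_nnreal]
        exact ENNReal.ofReal_le_ofReal (by linarith)
    _ = liminf (fun m : ℕ => ENNReal.ofReal (r + 1) * (μ (Ioi L)) ^ (1 / (m : ℝ))) atTop :=
        hlim.liminf_eq.symm
    _ ≤ _ := liminf_le_liminf (by
        filter_upwards [eventually_ge_atTop 1] with m hm using hlow m hm)

/-- The kernel, set to zero outside the open quadrant. -/
def Kt (K : ℝ → ℝ → ℝ) : ℝ × ℝ → ℝ :=
  (Ioi (0 : ℝ) ×ˢ Ioi (0 : ℝ)).indicator (fun p => K p.1 p.2)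

/-- The collision integrand. -/
def Bt (K : ℝ → ℝ → ℝ) (φ : ℝ → ℝ) (p : ℝ × ℝ) : ℝ :=
  Kt K p * (φ (p.1 + p.2) - φ p.1 - φ p.2)

section kern
variable {K h : ℝ → ℝ → ℝ} {g : ℝ → ℝ} {γ H H₀ H₁ G₀ G₁ k : ℝ}

lemma frac_mem {v v' : ℝ} (hv : 0 < v) (hv' : 0 < v') : v / (v + v') ∈ Icc (0 : ℝ) 1 := by
  constructor
  · positivity
  · rw [div_le_one (by positivity)]; linarith

lemma Kt_meas (hK : KernelAssumptionA K h g γ H H₀ H₁ G₀ G₁ k) : Measurable (Kt K) := by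
  have hs : MeasurableSet (Ioi (0 : ℝ) ×ˢ Ioi (0 : ℝ)) := measurableSet_Ioi.prod measurableSet_Ioi
  have h1 : ContinuousOn (fun p : ℝ × ℝ => h p.1 p.2) (Ioi (0 : ℝ) ×ˢ Ioi (0 : ℝ)) :=
    hK.h_cont.mono (prod_mono Ioi_subset_Ici_self Ioi_subset_Ici_self)
  have h2 : ContinuousOn (fun p : ℝ × ℝ => g (p.1 / (p.1 + p.2))) (Ioi (0 : ℝ) ×ˢ Ioi (0 : ℝ)) := by
    refine hK.g_cont.comp (f := fun p : ℝ × ℝ => p.1 / (p.1 + p.2)) ?_ ?_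
    · refine ContinuousOn.div (by fun_prop) (by fun_prop) ?_
      rintro ⟨v, v'⟩ ⟨hv, hv'⟩
      simp only [mem_Ioi] at hv hv'
      positivity
    · rintro ⟨v, v'⟩ ⟨hv, hv'⟩
      exact frac_mem hv hv'
  have h3 : ContinuousOn (fun p : ℝ × ℝ => K p.1 p.2) (Ioi (0 : ℝ) ×ˢ Ioi (0 : ℝ)) := by
    refine (h1.mul h2).congr ?_
    rintro ⟨v, v'⟩ ⟨hv, hv'⟩
    simp only [mem_Ioi] at hv hv'
    exact hK.K_eq v v' hv.le hv'.le (by positivity)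
  classical
  have h4 := h3.measurable_piecewise (g := fun _ => (0 : ℝ)) continuousOn_const hs
  have e : Kt K = (Ioi (0 : ℝ) ×ˢ Ioi (0 : ℝ)).piecewise (fun p : ℝ × ℝ => K p.1 p.2) (fun _ => 0) := by
    ext p
    simp only [Kt, Set.indicator, Set.piecewise]
  rw [e]
  exact h4

lemma Kt_nonneg (hK : KernelAssumptionA K h g γ H H₀ H₁ G₀ G₁ k) (p : ℝ × ℝ) : 0 ≤ Kt K p := by
  refine Set.indicator_nonneg ?_ p
  rintro ⟨v, v'⟩ ⟨hv, hv'⟩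
  exact hK.K_nonneg v v' (le_of_lt hv) (le_of_lt hv')

lemma Kt_eq {v v' : ℝ} (hv : 0 < v) (hv' : 0 < v') : Kt K (v, v') = K v v' := by
  rw [Kt, Set.indicator_of_mem (show (v, v') ∈ Ioi (0 : ℝ) ×ˢ Ioi (0 : ℝ) from ⟨hv, hv'⟩)]

lemma Kt_le (hK : KernelAssumptionA K h g γ H H₀ H₁ G₀ G₁ k) {v v' : ℝ} (hv : 0 < v)
    (hv' : 0 < v') : Kt K (v, v') ≤ H₁ * G₁ * ((1 + v ^ γ) * (1 + v' ^ γ)) := by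
  rw [Kt_eq hv hv', hK.K_eq v v' hv.le hv'.le (by positivity)]
  have hx := frac_mem hv hv'
  have hg0 : 0 ≤ g (v / (v + v')) :=
    le_trans (mul_nonneg hK.G₀_pos.le (Real.rpow_nonneg (abs_nonneg _) _)) (hK.g_lower _ hx)
  have hg1 := hK.g_upper _ hx
  have hh := hK.h_upper v v' hv.le hv'.le
  have a : 0 ≤ v ^ γ := Real.rpow_nonneg hv.le _
  have b : 0 ≤ v' ^ γ := Real.rpow_nonneg hv'.le _
  have := hK.H₁_pos
  have := hK.G₁_pos
  calc h v v' * g (v / (v + v')) ≤ H₁ * (v ^ γ + v' ^ γ) * g (v / (v + v')) := by gcongr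
    _ ≤ H₁ * (v ^ γ + v' ^ γ) * G₁ := by gcongr
    _ = H₁ * G₁ * (v ^ γ + v' ^ γ) := by ring
    _ ≤ _ := by
      gcongr
      nlinarith [mul_nonneg a b]

lemma Kt_pos (hK : KernelAssumptionA K h g γ H H₀ H₁ G₀ G₁ k) {v v' : ℝ} (hv : 0 < v)
    (hv' : 0 < v') (hne : v ≠ v') : 0 < Kt K (v, v') := by
  rw [Kt_eq hv hv', hK.K_eq v v' hv.le hv'.le (by positivity)]
  refine mul_pos ?_ ?_
  · have hR : 0 < v + v' + 1 / v + 1 / v' := by positivity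
    obtain ⟨C, hC, hCh⟩ := hK.h_posOn _ hR
    have p1 : 0 < 1 / v := by positivity
    have p2 : 0 < 1 / v' := by positivity
    refine hC.trans_le (hCh v ⟨?_, by linarith⟩ v' ⟨?_, by linarith⟩)
    · rw [div_le_iff₀ hR]
      have : v * (1 / v) = 1 := by field_simp
      nlinarith [mul_pos hv hv', mul_pos hv hv, mul_pos hv p2]
    · rw [div_le_iff₀ hR]
      have : v' * (1 / v') = 1 := by field_simp
      nlinarith [mul_pos hv hv', mul_pos hv' hv', mul_pos hv' p1]
  · refine lt_of_lt_of_le ?_ (hK.g_lower _ (frac_mem hv hv'))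
    refine mul_pos hK.G₀_pos (Real.rpow_pos_of_pos (abs_pos.2 ?_) _)
    intro h0
    apply hne
    have : v / (v + v') = 1 / 2 := by linarith
    rw [div_eq_div_iff (by positivity) (by norm_num)] at this
    linarith

lemma ae_pos {μ : Measure ℝ} (h0 : μ (Iic 0) = 0) : ∀ᵐ v ∂μ, 0 < v := by
  rw [ae_iff]; simpa [Iic] using h0

lemma fin_of_mom {μ : Measure ℝ} (h0 : μ (Iic 0) = 0)
    (hw : Integrable (fun v => 1 + v ^ γ) μ) : IsFiniteMeasure μ := by
  have : Integrable (fun _ : ℝ => (1 : ℝ)) μ := by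
    refine hw.mono' aestronglyMeasurable_const ?_
    filter_upwards [ae_pos h0] with v hv
    have : 0 ≤ v ^ γ := Real.rpow_nonneg hv.le _
    simp; linarith
  rw [integrable_const_iff] at this
  simpa using this

lemma mass_le {μ : Measure ℝ} (h0 : μ (Iic 0) = 0) {C : ℝ}
    (hw : Integrable (fun v => 1 + v ^ γ) μ) (hC : (∫ v, (1 + v ^ γ) ∂μ) ≤ C) :
    μ univ ≤ ENNReal.ofReal C := by
  have := fin_of_mom h0 hw
  have h1 : ∫ v, (1 : ℝ) ∂μ ≤ ∫ v, (1 + v ^ γ) ∂μ := by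
    refine integral_mono_ae (integrable_const _) hw ?_
    filter_upwards [ae_pos h0] with v hv
    have : 0 ≤ v ^ γ := Real.rpow_nonneg hv.le _
    simp; linarith
  simp [Measure.real] at h1
  rw [← ENNReal.ofReal_toReal (measure_ne_top μ univ)]
  exact ENNReal.ofReal_le_ofReal (h1.trans hC)

lemma ae_prod_pos {μ : Measure ℝ} [SFinite μ] (h0 : μ (Iic 0) = 0) :
    ∀ᵐ p ∂(μ.prod μ), 0 < p.1 ∧ 0 < p.2 := by
  have h := ae_pos h0
  exact (Measure.quasiMeasurePreserving_fst.ae h).and (Measure.quasiMeasurePreserving_snd.ae h)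

lemma Bt_bound (hK : KernelAssumptionA K h g γ H H₀ H₁ G₀ G₁ k) {φ : ℝ → ℝ} {M : ℝ}
    (hM : ∀ v, |φ v| ≤ M) {v v' : ℝ} (hv : 0 < v) (hv' : 0 < v') :
    |Bt K φ (v, v')| ≤ 3 * M * (H₁ * G₁) * ((1 + v ^ γ) * (1 + v' ^ γ)) := by
  have h1 := Kt_le hK hv hv'
  have h2 := Kt_nonneg hK (v, v')
  have h3 : |φ (v + v') - φ v - φ v'| ≤ 3 * M := by
    have a := abs_le.1 (hM (v + v'))
    have b := abs_le.1 (hM v)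
    have c := abs_le.1 (hM v')
    rw [abs_le]; constructor <;> linarith
  have hM0 : 0 ≤ M := (abs_nonneg _).trans (hM 0)
  rw [Bt, abs_mul, abs_of_nonneg h2]
  calc Kt K (v, v') * |φ (v + v') - φ v - φ v'|
      ≤ (H₁ * G₁ * ((1 + v ^ γ) * (1 + v' ^ γ))) * (3 * M) := by
        gcongr
        exact h2.trans h1
    _ = _ := by ring

lemma Bt_meas (hK : KernelAssumptionA K h g γ H H₀ H₁ G₀ G₁ k) {φ : ℝ → ℝ} (hφ : Measurable φ) :
    Measurable (Bt K φ) := by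
  have := Kt_meas hK
  unfold Bt
  fun_prop

lemma Bt_int (hK : KernelAssumptionA K h g γ H H₀ H₁ G₀ G₁ k) {μ : Measure ℝ} [IsFiniteMeasure μ]
    (h0 : μ (Iic 0) = 0) (hw : Integrable (fun v => 1 + v ^ γ) μ)
    {φ : ℝ → ℝ} (hφ : Measurable φ) {M : ℝ} (hM : ∀ v, |φ v| ≤ M) :
    Integrable (Bt K φ) (μ.prod μ) := by
  refine ((hw.mul_prod hw).const_mul (3 * M * (H₁ * G₁))).mono'
    (Bt_meas hK hφ).aestronglyMeasurable ?_
  filter_upwards [ae_prod_pos h0] with p hp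
  exact Bt_bound hK hM hp.1 hp.2

lemma Bt_int_le (hK : KernelAssumptionA K h g γ H H₀ H₁ G₀ G₁ k) {μ : Measure ℝ} [IsFiniteMeasure μ]
    (h0 : μ (Iic 0) = 0) (hw : Integrable (fun v => 1 + v ^ γ) μ) {C : ℝ}
    (hC : (∫ v, (1 + v ^ γ) ∂μ) ≤ C)
    {φ : ℝ → ℝ} {M : ℝ} (hM : ∀ v, |φ v| ≤ M) :
    ‖∫ p, Bt K φ p ∂(μ.prod μ)‖ ≤ 3 * M * (H₁ * G₁) * (C * C) := by
  have h1 : ‖∫ p, Bt K φ p ∂(μ.prod μ)‖ ≤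
      ∫ p : ℝ × ℝ, 3 * M * (H₁ * G₁) * ((1 + p.1 ^ γ) * (1 + p.2 ^ γ)) ∂(μ.prod μ) := by
    refine norm_integral_le_of_norm_le ((hw.mul_prod hw).const_mul (3 * M * (H₁ * G₁))) ?_
    filter_upwards [ae_prod_pos h0] with p hp
    exact Bt_bound hK hM hp.1 hp.2
  refine h1.trans ?_
  rw [integral_const_mul, integral_prod_mul (fun v : ℝ => 1 + v ^ γ) (fun v : ℝ => 1 + v ^ γ)]
  have hM0 : 0 ≤ M := (abs_nonneg _).trans (hM 0)
  have := hK.H₁_pos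
  have := hK.G₁_pos
  have hn : 0 ≤ ∫ v, (1 + v ^ γ) ∂μ := by
    refine integral_nonneg_of_ae ?_
    filter_upwards [ae_pos h0] with v hv
    have : 0 ≤ v ^ γ := Real.rpow_nonneg hv.le _
    simp; linarith
  gcongr
  exact hn.trans hC

lemma Bt_iter (hK : KernelAssumptionA K h g γ H H₀ H₁ G₀ G₁ k) {μ : Measure ℝ} [IsFiniteMeasure μ]
    (h0 : μ (Iic 0) = 0) (hw : Integrable (fun v => 1 + v ^ γ) μ)
    {φ : ℝ → ℝ} (hφ : Measurable φ) {M : ℝ} (hM : ∀ v, |φ v| ≤ M) :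
    (∫ v, (∫ v', K v v' * (φ (v + v') - φ v - φ v') ∂μ) ∂μ) = ∫ p, Bt K φ p ∂(μ.prod μ) := by
  rw [integral_prod _ (Bt_int hK h0 hw hφ hM)]
  refine integral_congr_ae ?_
  filter_upwards [ae_pos h0] with v hv
  refine integral_congr_ae ?_
  filter_upwards [ae_pos h0] with v' hv'
  simp only [Bt, Kt_eq hv hv']

end kern

/-- Clamp to `[0,L]`. -/
def psi (L v : ℝ) : ℝ := max 0 (min v L)

/-- Compactly supported approximations of `psi L`. -/
def psin (L : ℝ) (n : ℕ) (v : ℝ) : ℝ :=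
  psi L v * (psi 1 (((n : ℝ) + 1) * v - 1) * psi 1 ((n : ℝ) + 1 - v))

lemma psi_cont (L : ℝ) : Continuous (psi L) := by unfold psi; fun_prop

lemma psin_cont (L : ℝ) (n : ℕ) : Continuous (psin L n) := by unfold psin psi; fun_prop

lemma psi_nonneg (L v : ℝ) : 0 ≤ psi L v := le_max_left _ _

lemma psi_le {L : ℝ} (hL : 0 ≤ L) (v : ℝ) : psi L v ≤ L := max_le hL (min_le_right _ _)

lemma psi_abs {L : ℝ} (hL : 0 ≤ L) (v : ℝ) : |psi L v| ≤ L := by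
  rw [abs_of_nonneg (psi_nonneg _ _)]; exact psi_le hL v

lemma psin_abs {L : ℝ} (hL : 0 ≤ L) (n : ℕ) (v : ℝ) : |psin L n v| ≤ L := by
  have a := psi_nonneg 1 (((n : ℝ) + 1) * v - 1)
  have b := psi_le zero_le_one (((n : ℝ) + 1) * v - 1)
  have c := psi_nonneg 1 ((n : ℝ) + 1 - v)
  have d := psi_le zero_le_one ((n : ℝ) + 1 - v)
  have e := psi_nonneg L v
  have e' := psi_le hL v
  rw [psin, abs_of_nonneg (by positivity)]
  calc _ ≤ L * (1 * 1) := by gcongr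
    _ = L := by ring

lemma psin_supp (L : ℝ) (n : ℕ) : tsupport (psin L n) ⊆ Icc (1 / ((n : ℝ) + 1)) ((n : ℝ) + 1) := by
  refine closure_minimal ?_ isClosed_Icc
  intro v hv
  by_contra hcon
  apply hv
  have hn : (0 : ℝ) < (n : ℝ) + 1 := by positivity
  rw [mem_Icc, not_and_or, not_le, not_le] at hcon
  rcases hcon with h | h
  · rw [lt_div_iff₀ hn] at h
    have : psi 1 (((n : ℝ) + 1) * v - 1) = 0 := by
      rw [psi, max_eq_left]; exact (min_le_left _ _).trans (by nlinarith)
    simp [psin, this]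
  · have : psi 1 ((n : ℝ) + 1 - v) = 0 := by
      rw [psi, max_eq_left]; exact (min_le_left _ _).trans (by linarith)
    simp [psin, this]

lemma psin_tendsto (L : ℝ) {v : ℝ} (hv : 0 < v) :
    Tendsto (fun n => psin L n v) atTop (𝓝 (psi L v)) := by
  refine tendsto_const_nhds.congr' ?_
  obtain ⟨N, hN⟩ := exists_nat_gt (2 / v + v)
  filter_upwards [eventually_ge_atTop N] with n hn
  have hn' : (N : ℝ) ≤ n := by exact_mod_cast hn
  have h2 : 0 < 2 / v := by positivity
  have h1 : psi 1 (((n : ℝ) + 1) * v - 1) = 1 := by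
    have : 2 / v ≤ (n : ℝ) + 1 := by linarith
    rw [div_le_iff₀ hv] at this
    rw [psi, min_eq_right (by linarith), max_eq_right zero_le_one]
  have h3 : psi 1 ((n : ℝ) + 1 - v) = 1 := by
    rw [psi, min_eq_right (by linarith), max_eq_right zero_le_one]
  simp [psin, h1, h3]

lemma psi_sub {L : ℝ} (hL : 0 < L) {v v' : ℝ} (hv : 0 < v) (hv' : 0 < v') :
    psi L (v + v') - psi L v - psi L v' ≤ 0 := by
  unfold psi
  rw [max_eq_right (le_min (by positivity) hL.le), max_eq_right (le_min hv.le hL.le),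
    max_eq_right (le_min hv'.le hL.le)]
  rcases min_cases (v + v') L with h | h <;> rcases min_cases v L with h' | h' <;>
    rcases min_cases v' L with h'' | h'' <;> linarith

lemma psi_sub_lt {L : ℝ} (hL : 0 < L) {v v' : ℝ} (hv : 0 < v) (hv' : 0 < v') (hs : L < v + v') :
    psi L (v + v') - psi L v - psi L v' < 0 := by
  unfold psi
  rw [max_eq_right (le_min (by positivity) hL.le), max_eq_right (le_min hv.le hL.le),
    max_eq_right (le_min hv'.le hL.le)]
  rcases min_cases (v + v') L with h | h <;> rcases min_cases v L with h' | h' <;>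
    rcases min_cases v' L with h'' | h'' <;> linarith

lemma psi_tendsto_int (L : ℝ) (hL : 0 < L) {μ : Measure ℝ} [IsFiniteMeasure μ]
    (h0 : μ (Iic 0) = 0) :
    Tendsto (fun n => ∫ v, psin L n v ∂μ) atTop (𝓝 (∫ v, psi L v ∂μ)) := by
  refine tendsto_integral_of_dominated_convergence (fun _ => L)
    (fun n => (psin_cont L n).aestronglyMeasurable) (integrable_const _)
    (fun n => Eventually.of_forall fun v => psin_abs hL.le n v) ?_
  filter_upwards [ae_pos h0] with v hv using psin_tendsto L hv

section main
variable {K h : ℝ → ℝ → ℝ} {g : ℝ → ℝ} {γ H H₀ H₁ G₀ G₁ k : ℝ}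

lemma Bt_tendsto_int (hK : KernelAssumptionA K h g γ H H₀ H₁ G₀ G₁ k) {μ : Measure ℝ}
    [IsFiniteMeasure μ] (h0 : μ (Iic 0) = 0) (hw : Integrable (fun v => 1 + v ^ γ) μ)
    {L : ℝ} (hL : 0 < L) :
    Tendsto (fun n => ∫ p, Bt K (psin L n) p ∂(μ.prod μ)) atTop
      (𝓝 (∫ p, Bt K (psi L) p ∂(μ.prod μ))) := by
  refine tendsto_integral_of_dominated_convergence
    (fun p : ℝ × ℝ => 3 * L * (H₁ * G₁) * ((1 + p.1 ^ γ) * (1 + p.2 ^ γ)))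
    (fun n => (Bt_meas hK (psin_cont L n).measurable).aestronglyMeasurable)
    ((hw.mul_prod hw).const_mul (3 * L * (H₁ * G₁))) (fun n => ?_) ?_
  · filter_upwards [ae_prod_pos h0] with p hp
    exact Bt_bound hK (psin_abs hL.le n) hp.1 hp.2
  · filter_upwards [ae_prod_pos h0] with p hp
    unfold Bt
    exact (((psin_tendsto L (add_pos hp.1 hp.2)).sub (psin_tendsto L hp.1)).sub
      (psin_tendsto L hp.2)).const_mul _

/-- The weak formulation extended to the test function `psi L`. -/
lemma weak_psi (hK : KernelAssumptionA K h g γ H H₀ H₁ G₀ G₁ k) {T : ℝ} (hT : 0 < T)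
    {fin : Measure ℝ} (hconc : fin (Iic 0) = 0)
    (hγmom : Integrable (fun v => 1 + v ^ γ) fin)
    {f : ℝ → Measure ℝ} (hf : IsWeakSolution K γ T f fin) {L : ℝ} (hL : 0 < L) :
    IntervalIntegrable (fun s => ∫ p, Bt K (psi L) p ∂((f s).prod (f s))) volume 0 T ∧
    ∀ t ∈ Icc (0 : ℝ) T, (∫ v, psi L v ∂(f t)) - (∫ v, psi L v ∂fin) =
      (1 / 2) * ∫ s in (0 : ℝ)..t, ∫ p, Bt K (psi L) p ∂((f s).prod (f s)) := by
  obtain ⟨C, hC⟩ := hf.moment_bound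
  have hfinm : ∀ t ∈ Icc (0 : ℝ) T, IsFiniteMeasure (f t) := fun t ht =>
    fin_of_mom (hf.conc t ht) (hC t ht).1
  have : IsFiniteMeasure fin := fin_of_mom hconc hγmom
  have hmem : ∀ s : ℝ, max 0 (min s T) ∈ Icc (0 : ℝ) T := fun s =>
    ⟨le_max_left _ _, max_le hT.le (min_le_right _ _)⟩
  have hcl : ∀ s ∈ Icc (0 : ℝ) T, max 0 (min s T) = s := fun s hs => by
    rw [min_eq_left hs.2, max_eq_right hs.1]
  have hmeas := meas_family T hT f hfinm hf.time_cont
  have hmB : ∀ φ : ℝ → ℝ, Measurable φ → ∀ t ∈ Icc (0 : ℝ) T, AEStronglyMeasurable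
      (fun s => ∫ p, Bt K φ p ∂((f s).prod (f s))) (volume.restrict (uIoc 0 t)) := by
    intro φ hφ t ht
    have h1 := meas_prod _ hmeas (ENNReal.ofReal C) ENNReal.ofReal_lt_top
      (fun s => mass_le (hf.conc _ (hmem s)) (hC _ (hmem s)).1 (hC _ (hmem s)).2)
      (Bt K φ) (Bt_meas hK hφ)
    refine h1.aestronglyMeasurable.congr ?_
    filter_upwards [ae_restrict_mem measurableSet_uIoc] with s hs
    rw [uIoc_of_le ht.1] at hs
    simp only [hcl s ⟨hs.1.le, hs.2.trans ht.2⟩]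
  constructor
  · rw [intervalIntegrable_iff]
    refine Integrable.mono' (g := fun _ => 3 * L * (H₁ * G₁) * (C * C)) ?_
      (hmB _ (psi_cont L).measurable T ⟨hT.le, le_rfl⟩) ?_
    · exact intervalIntegrable_iff.1 intervalIntegrable_const
    · filter_upwards [ae_restrict_mem measurableSet_uIoc] with s hs
      rw [uIoc_of_le hT.le] at hs
      have hs' : s ∈ Icc (0 : ℝ) T := ⟨hs.1.le, hs.2⟩
      have := hfinm s hs'
      exact Bt_int_le hK (hf.conc s hs') (hC s hs').1 (hC s hs').2 (psi_abs hL.le)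
  · intro t ht
    have := hfinm t ht
    have hlhs : Tendsto (fun n => (∫ v, psin L n v ∂(f t)) - (∫ v, psin L n v ∂fin)) atTop
        (𝓝 ((∫ v, psi L v ∂(f t)) - (∫ v, psi L v ∂fin))) :=
      (psi_tendsto_int L hL (hf.conc t ht)).sub (psi_tendsto_int L hL hconc)
    refine tendsto_nhds_unique hlhs ?_
    have heq : ∀ n, (∫ v, psin L n v ∂(f t)) - (∫ v, psin L n v ∂fin) =
        (1 / 2) * ∫ s in (0 : ℝ)..t, ∫ p, Bt K (psin L n) p ∂((f s).prod (f s)) := by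
      intro n
      have hn : (0 : ℝ) < 1 / ((n : ℝ) + 1) := by positivity
      rw [hf.weak_form (psin L n) (psin_cont L n)
        (HasCompactSupport.of_support_subset_isCompact isCompact_Icc
          ((subset_tsupport _).trans (psin_supp L n)))
        ((psin_supp L n).trans fun v hv => hn.trans_le hv.1) t ht]
      congr 1
      refine intervalIntegral.integral_congr fun s hs => ?_
      rw [uIcc_of_le ht.1] at hs
      have hs' : s ∈ Icc (0 : ℝ) T := ⟨hs.1, hs.2.trans ht.2⟩
      have := hfinm s hs'
      exact Bt_iter hK (hf.conc s hs') (hC s hs').1 (psin_cont L n).measurable (psin_abs hL.le n)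
    simp only [heq]
    refine Tendsto.const_mul _ ?_
    refine intervalIntegral.tendsto_integral_filter_of_dominated_convergence
      (fun _ => 3 * L * (H₁ * G₁) * (C * C)) ?_ ?_ ?_ ?_
    · exact Eventually.of_forall fun n => hmB _ (psin_cont L n).measurable t ht
    · refine Eventually.of_forall fun n => Eventually.of_forall fun s hs => ?_
      rw [uIoc_of_le ht.1] at hs
      have hs' : s ∈ Icc (0 : ℝ) T := ⟨hs.1.le, hs.2.trans ht.2⟩
      have := hfinm s hs'
      exact Bt_int_le hK (hf.conc s hs') (hC s hs').1 (hC s hs').2 (psin_abs hL.le n)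
    · exact intervalIntegrable_const
    · refine Eventually.of_forall fun s hs => ?_
      rw [uIoc_of_le ht.1] at hs
      have hs' : s ∈ Icc (0 : ℝ) T := ⟨hs.1.le, hs.2.trans ht.2⟩
      have := hfinm s hs'
      exact Bt_tendsto_int hK (hf.conc s hs') (hC s hs').1 hL

/-- Vanishing tail is equivalent to the truncated mass being the full mass. -/
lemma tail_iff {μ : Measure ℝ} [IsFiniteMeasure μ] (h0 : μ (Iic 0) = 0)
    (hi : Integrable (fun v => v) μ) {L : ℝ} (hL : 0 < L) :
    (∫ v, psi L v ∂μ) ≤ (∫ v, v ∂μ) ∧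
      (μ (Ioi L) = 0 ↔ (∫ v, v ∂μ) = ∫ v, psi L v ∂μ) := by
  have hp : Integrable (psi L) μ :=
    Integrable.of_bound (psi_cont L).aestronglyMeasurable L (Eventually.of_forall (psi_abs hL.le))
  have hle : ∀ v : ℝ, 0 < v → psi L v ≤ v := fun v hv =>
    max_le hv.le (min_le_left _ _)
  have hnn : 0 ≤ᵐ[μ] fun v => v - psi L v := by
    filter_upwards [ae_pos h0] with v hv using sub_nonneg.2 (hle v hv)
  refine ⟨integral_mono_ae hp hi (by filter_upwards [ae_pos h0] with v hv using hle v hv), ?_⟩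
  rw [← sub_eq_zero (a := ∫ v, v ∂μ), ← integral_sub hi hp,
    integral_eq_zero_iff_of_nonneg_ae hnn (hi.sub hp)]
  have e : μ (Ioi L) = 0 ↔ ∀ᵐ v ∂μ, v ≤ L := by
    rw [ae_iff]; simp [Ioi]
  rw [e]
  constructor
  · intro h
    filter_upwards [h, ae_pos h0] with v h1 h2
    simp [psi, min_eq_left h1, max_eq_right h2.le]
  · intro h
    filter_upwards [h, ae_pos h0] with v h1 h2
    by_contra h3
    push Not at h3
    simp [psi, min_eq_right h3.le, max_eq_right hL.le] at h1
    linarith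

lemma D_nonpos (hK : KernelAssumptionA K h g γ H H₀ H₁ G₀ G₁ k) {μ : Measure ℝ}
    [IsFiniteMeasure μ] (h0 : μ (Iic 0) = 0) {L : ℝ} (hL : 0 < L) :
    0 ≤ᵐ[μ.prod μ] fun p => - Bt K (psi L) p := by
  filter_upwards [ae_prod_pos h0] with p hp
  have h1 := Kt_nonneg hK p
  have h2 := psi_sub hL hp.1 hp.2
  simp only [Pi.zero_apply, Bt]
  nlinarith

/-- No dissipation is incompatible with charging two separated regions. -/
lemma D_zero (hK : KernelAssumptionA K h g γ H H₀ H₁ G₀ G₁ k) {μ : Measure ℝ}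
    [IsFiniteMeasure μ] (h0 : μ (Iic 0) = 0) (hw : Integrable (fun v => 1 + v ^ γ) μ)
    {L a₁ a₂ : ℝ} (hL : 0 < L) (ha₁ : 0 < a₁) (hLa : a₂ ≤ L - a₁)
    (hA : 0 < μ (Ioo a₁ a₂)) (hB : 0 < μ (Ioi (L - a₁)))
    (hD : ∫ p, Bt K (psi L) p ∂(μ.prod μ) = 0) : False := by
  have hi := Bt_int hK h0 hw (psi_cont L).measurable (psi_abs hL.le)
  have h1 : ∫ p, - Bt K (psi L) p ∂(μ.prod μ) = 0 := by rw [integral_neg, hD, neg_zero]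
  rw [integral_eq_zero_iff_of_nonneg_ae (D_nonpos hK h0 hL) hi.neg] at h1
  have h2 : (μ.prod μ) (Ioo a₁ a₂ ×ˢ Ioi (L - a₁)) = 0 := by
    refine measure_mono_null ?_ h1
    rintro ⟨v, v'⟩ ⟨⟨hv1, hv2⟩, hv'⟩
    simp only [mem_Ioi] at hv1 hv2 hv'
    have hv : 0 < v := ha₁.trans hv1
    have hv'0 : 0 < v' := by linarith
    have hk := Kt_pos hK hv hv'0 (by linarith : v < v').ne
    have hp := psi_sub_lt hL hv hv'0 (by linarith)
    have : Bt K (psi L) (v, v') < 0 := mul_neg_of_pos_of_neg hk hp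
    intro hcon
    have hcon' : - Bt K (psi L) (v, v') = 0 := hcon
    linarith
  rw [Measure.prod_prod] at h2
  exact (ENNReal.mul_pos hA.ne' hB.ne').ne' h2

/-- A tent function. -/
def tent (a b v : ℝ) : ℝ := max 0 (min (v - a) (b - v))

lemma tent_cont (a b : ℝ) : Continuous (tent a b) := by unfold tent; fun_prop

lemma tent_abs {a b : ℝ} (hab : a < b) (v : ℝ) : |tent a b v| ≤ b - a := by
  unfold tent
  rw [abs_of_nonneg (le_max_left _ _)]
  refine max_le (by linarith) ?_
  rcases min_cases (v - a) (b - v) with h | h <;> linarith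

lemma tent_supp (a b : ℝ) : Function.support (tent a b) = Ioo a b := by
  ext v
  rw [Function.mem_support, tent]
  constructor
  · intro hne
    by_contra hcon
    apply hne
    rw [max_eq_left]
    rw [mem_Ioo, not_and_or, not_lt, not_lt] at hcon
    rcases hcon with h | h
    · exact (min_le_left _ _).trans (by linarith)
    · exact (min_le_right _ _).trans (by linarith)
  · rintro ⟨h1, h2⟩
    exact (lt_max_of_lt_right (lt_min (by linarith) (by linarith))).ne'

lemma tent_pos {μ : Measure ℝ} [IsFiniteMeasure μ] {a b : ℝ} (hab : a < b) :
    0 < ∫ v, tent a b v ∂μ ↔ 0 < μ (Ioo a b) := by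
  rw [integral_pos_iff_support_of_nonneg (f := tent a b) (fun v => le_max_left _ _)
    (Integrable.of_bound (tent_cont a b).aestronglyMeasurable (b - a)
      (Eventually.of_forall (tent_abs hab))), tent_supp]

/-- Positivity on an interval persists for short times. -/
lemma short_time {T : ℝ} (hT : 0 < T) {fin : Measure ℝ} [IsFiniteMeasure fin]
    {f : ℝ → Measure ℝ} (hf : IsWeakSolution K γ T f fin) {a b : ℝ} (ha : 0 < a) (hab : a < b)
    (hp : 0 < fin (Ioo a b)) :
    ∃ δ > 0, ∀ s ∈ Icc (0 : ℝ) T, s < δ → 0 < f s (Ioo a b) := by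
  have h0 : (∫ v, tent a b v ∂(f 0)) = ∫ v, tent a b v ∂fin := by
    have hs : tsupport (tent a b) ⊆ Icc a b := by
      refine closure_minimal ?_ isClosed_Icc
      rw [tent_supp]
      exact Ioo_subset_Icc_self
    have := hf.weak_form (tent a b) (tent_cont a b)
      (HasCompactSupport.of_support_subset_isCompact isCompact_Icc ((subset_tsupport _).trans hs))
      (hs.trans fun v hv => ha.trans_le hv.1) 0 ⟨le_rfl, hT.le⟩
    simp only [intervalIntegral.integral_same, mul_zero] at this
    linarith
  have hpos : 0 < ∫ v, tent a b v ∂(f 0) := by rw [h0]; exact (tent_pos hab).2 hp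
  have hc := (hf.time_cont (tent a b) (tent_cont a b) ⟨_, tent_abs hab⟩) 0 ⟨le_rfl, hT.le⟩
  have hev := hc.eventually (lt_mem_nhds hpos)
  rw [eventually_nhdsWithin_iff, Metric.eventually_nhds_iff] at hev
  obtain ⟨δ, hδ, hh⟩ := hev
  refine ⟨δ, hδ, fun s hs hsδ => ?_⟩
  obtain ⟨C, hC⟩ := hf.moment_bound
  have := fin_of_mom (hf.conc s hs) (hC s hs).1
  refine (tent_pos hab).1 (hh ?_ hs)
  rw [Real.dist_eq, sub_zero, abs_of_nonneg hs.1]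
  exact hsδ

/-- The support of the solution is unbounded at every positive time. -/
lemma unbounded_support (hK : KernelAssumptionA K h g γ H H₀ H₁ G₀ G₁ k) {T : ℝ} (hT : 0 < T)
    {fin : Measure ℝ} (hconc : fin (Iic 0) = 0) (hne : fin ≠ 0)
    (hγmom : Integrable (fun v => 1 + v ^ γ) fin)
    (hdirac : ¬ IsSingleDirac fin)
    {f : ℝ → Measure ℝ} (hf : IsWeakSolution K γ T f fin)
    (hmc : IsMassConserving T f fin) {t : ℝ} (ht : t ∈ Ioc 0 T) (L : ℝ) : 0 < f t (Ioi L) := by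
  obtain ⟨C, hC⟩ := hf.moment_bound
  have hfinm : ∀ t ∈ Icc (0 : ℝ) T, IsFiniteMeasure (f t) := fun t ht =>
    fin_of_mom (hf.conc t ht) (hC t ht).1
  have : IsFiniteMeasure fin := fin_of_mom hconc hγmom
  have hDle : ∀ L : ℝ, 0 < L → ∀ s ∈ Icc (0 : ℝ) T,
      ∫ p, Bt K (psi L) p ∂((f s).prod (f s)) ≤ 0 := by
    intro L hL s hs
    have := hfinm s hs
    have h1 := integral_nonneg_of_ae (D_nonpos hK (hf.conc s hs) hL)
    rw [integral_neg] at h1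
    linarith
  -- monotonicity of the tail in time
  have hmono : ∀ L : ℝ, 0 < L → ∀ t₁ t₂ : ℝ, 0 ≤ t₁ → t₁ ≤ t₂ → t₂ ≤ T →
      f t₂ (Ioi L) = 0 → f t₁ (Ioi L) = 0 := by
    intro L hL t₁ t₂ h1 h12 h2 hz
    have m1 : t₁ ∈ Icc (0 : ℝ) T := ⟨h1, h12.trans h2⟩
    have m2 : t₂ ∈ Icc (0 : ℝ) T := ⟨h1.trans h12, h2⟩
    have := hfinm _ m1
    have := hfinm _ m2
    obtain ⟨hInt, hw⟩ := weak_psi hK hT hconc hγmom hf hL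
    have e1 := hw t₁ m1
    have e2 := hw t₂ m2
    have i1 := hInt.mono_set (c := 0) (d := t₁)
      (by rw [uIcc_of_le h1, uIcc_of_le hT.le]; exact Icc_subset_Icc le_rfl m1.2)
    have i2 := hInt.mono_set (c := t₁) (d := t₂)
      (by rw [uIcc_of_le h12, uIcc_of_le hT.le]; exact Icc_subset_Icc h1 h2)
    rw [← intervalIntegral.integral_add_adjacent_intervals i1 i2] at e2
    have hle : ∫ s in t₁..t₂, ∫ p, Bt K (psi L) p ∂((f s).prod (f s)) ≤ 0 := by
      have : 0 ≤ ∫ s in t₁..t₂, - ∫ p, Bt K (psi L) p ∂((f s).prod (f s)) :=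
        intervalIntegral.integral_nonneg h12 fun s hs =>
          neg_nonneg.2 (hDle L hL s ⟨h1.trans hs.1, hs.2.trans h2⟩)
      rw [intervalIntegral.integral_neg] at this
      linarith
    have q1 := tail_iff (hf.conc _ m1) (hmc.2 _ m1).1 hL
    have q2 := tail_iff (hf.conc _ m2) (hmc.2 _ m2).1 hL
    have q3 := q2.2.1 hz
    have c1 := (hmc.2 _ m1).2
    have c2 := (hmc.2 _ m2).2
    rw [q1.2]
    linarith [q1.1]
  -- vanishing tails imply vanishing dissipation at some earlier time
  have hdis : ∀ L : ℝ, 0 < L → ∀ t ∈ Ioc (0 : ℝ) T, f t (Ioi L) = 0 →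
      ∃ s ∈ Ioc (0 : ℝ) t, ∫ p, Bt K (psi L) p ∂((f s).prod (f s)) = 0 := by
    intro L hL t ht hz
    have m : t ∈ Icc (0 : ℝ) T := ⟨ht.1.le, ht.2⟩
    have := hfinm _ m
    obtain ⟨hInt, hw⟩ := weak_psi hK hT hconc hγmom hf hL
    have e := hw t m
    have q := (tail_iff (hf.conc _ m) (hmc.2 _ m).1 hL).2.1 hz
    have q0 := (tail_iff hconc hmc.1 hL).1
    have c := (hmc.2 _ m).2
    by_contra hcon
    push Not at hcon
    have i1 := hInt.mono_set (c := 0) (d := t)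
      (by rw [uIcc_of_le m.1, uIcc_of_le hT.le]; exact Icc_subset_Icc le_rfl m.2)
    have hpos : 0 < ∫ s in (0 : ℝ)..t, - ∫ p, Bt K (psi L) p ∂((f s).prod (f s)) := by
      refine intervalIntegral.intervalIntegral_pos_of_pos_on i1.neg (fun s hs => ?_) ht.1
      have hne := hcon s ⟨hs.1, hs.2.le⟩
      exact neg_pos.2 (lt_of_le_of_ne (hDle L hL s ⟨hs.1.le, hs.2.le.trans ht.2⟩) hne)
    rw [intervalIntegral.integral_neg] at hpos
    linarith
  obtain ⟨a₁, a₂, b₁, b₂, ha₁, ha, hab, hb, hA, hB⟩ := two_regions fin hconc hne hdirac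
  obtain ⟨δ₁, hδ₁, hA'⟩ := short_time hT hf ha₁ ha hA
  obtain ⟨δ₂, hδ₂, hB'⟩ := short_time hT hf (by linarith) hb hB
  have hstep : ∀ n : ℕ, ∀ s ∈ Ioc (0 : ℝ) T, s < min δ₁ δ₂ → 0 < f s (Ioi (b₁ + n * a₁)) := by
    intro n
    induction n with
    | zero =>
      intro s hs hsδ
      refine (hB' s ⟨hs.1.le, hs.2⟩ (hsδ.trans_le (min_le_right _ _))).trans_le (measure_mono ?_)
      intro v hv
      simpa using hv.1
    | succ n ih =>
      intro s hs hsδ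
      by_contra hz
      have hz' : f s (Ioi (b₁ + ((n + 1 : ℕ) : ℝ) * a₁)) = 0 := by simpa using hz
      have hna : 0 ≤ (n : ℝ) * a₁ := by positivity
      have eL : b₁ + ((n + 1 : ℕ) : ℝ) * a₁ = b₁ + n * a₁ + a₁ := by push_cast; ring
      rw [eL] at hz'
      have hLpos : 0 < b₁ + n * a₁ + a₁ := by linarith
      obtain ⟨r, hr, hD⟩ := hdis _ hLpos s hs hz'
      have hr' : r ∈ Icc (0 : ℝ) T := ⟨hr.1.le, hr.2.trans hs.2⟩
      have hrδ : r < min δ₁ δ₂ := hr.2.trans_lt hsδ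
      have := hfinm r hr'
      refine D_zero hK (hf.conc r hr') (hC r hr').1 (a₁ := a₁) (a₂ := a₂) hLpos ha₁ (by linarith)
        (hA' r hr' (hrδ.trans_le (min_le_left _ _))) ?_ hD
      rw [add_sub_cancel_right]
      exact ih r ⟨hr.1, hr'.2⟩ hrδ
  obtain ⟨n, hn⟩ := exists_nat_gt (L / a₁)
  rw [div_lt_iff₀ ha₁] at hn
  have hnL : 0 < b₁ + n * a₁ := by
    have : 0 ≤ (n : ℝ) * a₁ := by positivity
    linarith
  have hmin : 0 < min δ₁ δ₂ := lt_min hδ₁ hδ₂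
  have hpos : 0 < f t (Ioi (b₁ + n * a₁)) := by
    by_contra hz
    have hz' : f t (Ioi (b₁ + n * a₁)) = 0 := by simpa using hz
    have hs0 : 0 < min t (min δ₁ δ₂ / 2) := lt_min ht.1 (by linarith)
    have h1 := hmono _ hnL (min t (min δ₁ δ₂ / 2)) t hs0.le (min_le_left _ _) ht.2 hz'
    have h2 := hstep n (min t (min δ₁ δ₂ / 2)) ⟨hs0, (min_le_left _ _).trans ht.2⟩
      ((min_le_right _ _).trans_lt (by linarith))
    exact h2.ne' h1
  refine hpos.trans_le (measure_mono fun v hv => ?_)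
  have : b₁ + n * a₁ < v := hv
  show L < v
  linarith

end main

/-- Divergence of high-order tail moments: for
`M_{R,m}(f(t)) = ∫_{[R,∞)} (v-R)^m f(dv,t)` one has
`liminf_{m→∞} M_{R,m}(f(t))^{1/m} ≥ R` for every `R > 0`, and hence
`liminf_{R→∞} liminf_{m→∞} M_{R,m}(f(t))^{1/m} = ∞`, for every `t ∈ (0,T]`. -/
theorem tail_moments_diverge
    (K h : ℝ → ℝ → ℝ) (g : ℝ → ℝ) (γ H H₀ H₁ G₀ G₁ k : ℝ)
    (hK : KernelAssumptionA K h g γ H H₀ H₁ G₀ G₁ k)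
    (T : ℝ) (hT : 0 < T)
    (fin : Measure ℝ) (hconc : fin (Iic 0) = 0) (hne : fin ≠ 0)
    (hγmom : Integrable (fun v => 1 + v ^ γ) fin)
    (hdirac : ¬ IsSingleDirac fin)
    (f : ℝ → Measure ℝ) (hf : IsWeakSolution K γ T f fin)
    (hmc : IsMassConserving T f fin) :
    ∀ t ∈ Ioc (0 : ℝ) T,
      (∀ R : ℝ, 0 < R →
        ENNReal.ofReal R ≤ Filter.liminf
          (fun m : ℕ =>
            (∫⁻ v in Ici R, ENNReal.ofReal ((v - R) ^ m) ∂(f t)) ^ (1 / (m : ℝ)))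
          Filter.atTop) ∧
      Filter.liminf (fun R : ℝ =>
        Filter.liminf
          (fun m : ℕ =>
            (∫⁻ v in Ici R, ENNReal.ofReal ((v - R) ^ m) ∂(f t)) ^ (1 / (m : ℝ)))
          Filter.atTop) Filter.atTop = (⊤ : ENNReal) := by
  intro t ht
  obtain ⟨C, hC⟩ := hf.moment_bound
  have hm : t ∈ Icc (0 : ℝ) T := ⟨ht.1.le, ht.2⟩
  have := fin_of_mom (hf.conc t hm) (hC t hm).1
  have key := liminf_top (f t)
    (fun L => unbounded_support hK hT hconc hne hγmom hdirac hf hmc ht L)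
  refine ⟨fun R _ => by rw [key R]; exact le_top, ?_⟩
  simp only [key]
  exact liminf_const _
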